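/- Let {S_{a^[k]}, k≥0} and {S_{a^{*[k]}}, k≥0} be two local non-stationary subdivision schemes which both reproduce constants, with difference mask sequences {q^[k]} and {q^{*[k]}}, and assume that at least one of the two schemes is bounded. Then {a^[k]} and {a^{*[k]}} are asymptotically similar if and only if for every fixed integer p ≥ 0, lim_{k→∞} ‖S_{q^[k+p]} ⋯ S_{q^[k+1]} S_{q^[k]} − S_{q^{*[k+p]}} ⋯ S_{q^{*[k+1]}} S_{q^{*[k]}}‖ = 0, where ‖·‖ is the operator sup-norm on bounded sequences. -/

import Mathlib

open Filter Set

/-- The subdivision operator associated to a mask `a`: `(S_a f)_i = ∑_j a_{i-2j} f_j`. -/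
noncomputable def subOp (a : ℤ → ℝ) (f : ℤ → ℝ) : ℤ → ℝ :=
  fun i => ∑ᶠ j : ℤ, a (i - 2 * j) * f j

/-- The difference mask `q` of a mask `a`: `q_i = ∑_{j ≤ i} (-1)^(i-j) a_j`. -/
noncomputable def diffMask (a : ℤ → ℝ) : ℤ → ℝ :=
  fun i => ∑ᶠ j ∈ {j : ℤ | j ≤ i}, (-1 : ℝ) ^ (i - j) * a j

/-- A sequence is bounded. -/
def IsBoundedSeq (f : ℤ → ℝ) : Prop := ∃ M : ℝ, ∀ i, |f i| ≤ M

/-- Sup-norm of a sequence. -/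
noncomputable def seqNorm (f : ℤ → ℝ) : ℝ := ⨆ i : ℤ, |f i|

/-- Operator sup-norm of an operator on sequences, taken over bounded sequences of
sup-norm at most one. -/
noncomputable def opNorm (T : (ℤ → ℝ) → ℤ → ℝ) : ℝ :=
  sSup { c : ℝ | ∃ f : ℤ → ℝ, IsBoundedSeq f ∧ seqNorm f ≤ 1 ∧ c = seqNorm (T f) }

/-- The hat function `H(x) = max (1 - |x|) 0`. -/
noncomputable def hatF (x : ℝ) : ℝ := max (1 - |x|) 0

/-- The piecewise linear interpolant at level `k` of the data `f` on the grid `2^{-k} ℤ`. -/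
noncomputable def PL (k : ℕ) (f : ℤ → ℝ) : ℝ → ℝ :=
  fun x => ∑ᶠ i : ℤ, f i * hatF (2 ^ k * x - (i : ℝ))

/-- Backward difference operator on sequences. -/
def bdiff (f : ℤ → ℝ) : ℤ → ℝ := fun i => f i - f (i - 1)

/-- `compOps q k n = S_{q^[k+n-1]} ∘ ⋯ ∘ S_{q^[k+1]} ∘ S_{q^[k]}`. -/
noncomputable def compOps (q : ℕ → ℤ → ℝ) (k : ℕ) : ℕ → (ℤ → ℝ) → ℤ → ℝ
  | 0 => id
  | n + 1 => subOp (q (k + n)) ∘ compOps q k n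

/-- A mask reproduces constants: `∑_i a_{2i} = ∑_i a_{2i+1} = 1`. -/
def ReproducesConstants (a : ℤ → ℝ) : Prop :=
  (∑ᶠ i : ℤ, a (2 * i)) = 1 ∧ (∑ᶠ i : ℤ, a (2 * i + 1)) = 1

/-- Two sequences of masks are asymptotically similar. -/
def AsympSimilar (a b : ℕ → ℤ → ℝ) : Prop :=
  Tendsto (fun k => seqNorm (fun i => a k i - b k i)) atTop (nhds 0)

/-- Condition A for a non-stationary scheme with masks `a`. -/
def ConditionA (a : ℕ → ℤ → ℝ) : Prop :=
  ∃ K n : ℕ, 0 < n ∧ ∃ μ : ℝ, μ < 1 ∧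
    ∀ k, K ≤ k → opNorm (compOps (fun j => diffMask (a j)) k n) ≤ μ

def Loc (L : ℕ) (c : ℤ → ℝ) : Prop := ∀ i : ℤ, (L : ℤ) < |i| → c i = 0

lemma Loc.mem {L : ℕ} {c : ℤ → ℝ} (h : Loc L c) {i : ℤ} (hi : c i ≠ 0) :
    -(L:ℤ) ≤ i ∧ i ≤ L := by
  by_contra hh
  exact hi (h i (by
    rw [lt_abs]; omega))

lemma subOp_eq {L : ℕ} {c : ℤ → ℝ} (h : Loc L c) (f : ℤ → ℝ) (i : ℤ) :
    subOp c f i = ∑ j ∈ Finset.Icc ((i - L) / 2) ((i + L) / 2), c (i - 2 * j) * f j := by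
  unfold subOp
  apply finsum_eq_sum_of_support_subset
  intro j hj
  have h1 : c (i - 2 * j) ≠ 0 := fun h0 => hj (by simp [h0])
  have := h.mem h1
  simp only [Finset.coe_Icc, Set.mem_Icc]
  omega

lemma subOp_bound {L : ℕ} {c : ℤ → ℝ} (h : Loc L c) {f : ℤ → ℝ} {M B : ℝ}
    (hM : ∀ i, |c i| ≤ M) (hB : ∀ i, |f i| ≤ B) (i : ℤ) :
    |subOp c f i| ≤ (L + 2) * (M * B) := by
  have hM0 : 0 ≤ M := (abs_nonneg _).trans (hM 0)
  have hB0 : 0 ≤ B := (abs_nonneg _).trans (hB 0)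
  rw [subOp_eq h]
  refine (Finset.abs_sum_le_sum_abs _ _).trans ?_
  refine (Finset.sum_le_card_nsmul _ _ (M * B) ?_).trans ?_
  · intro j _
    rw [abs_mul]
    exact mul_le_mul (hM _) (hB _) (abs_nonneg _) hM0
  · rw [nsmul_eq_mul]
    refine mul_le_mul_of_nonneg_right ?_ (mul_nonneg hM0 hB0)
    have : (Finset.Icc ((i - L) / 2) ((i + L) / 2)).card ≤ L + 2 := by
      rw [Int.card_Icc]; omega
    exact_mod_cast this

lemma subOp_sub {L : ℕ} {c d : ℤ → ℝ} (hc : Loc L c) (hd : Loc L d) (f g : ℤ → ℝ) (i : ℤ) :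
    subOp c f i - subOp d g i =
      subOp c (fun j => f j - g j) i + subOp (fun j => c j - d j) g i := by
  have hcd : Loc L (fun j => c j - d j) := fun j hj => by simp [hc j hj, hd j hj]
  rw [subOp_eq hc, subOp_eq hd, subOp_eq hc, subOp_eq hcd, ← Finset.sum_sub_distrib,
    ← Finset.sum_add_distrib]
  refine Finset.sum_congr rfl fun j _ => ?_
  ring

lemma subOp_delta (c : ℤ → ℝ) (i : ℤ) : subOp c (fun j => if j = 0 then 1 else 0) i = c i := by
  unfold subOp
  rw [finsum_eq_single _ 0]
  · simp
  · intro j hj; simp [hj]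

lemma Loc.bdd {L : ℕ} {c : ℤ → ℝ} (h : Loc L c) : ∃ M : ℝ, ∀ i, |c i| ≤ M := by
  refine ⟨∑ j ∈ Finset.Icc (-(L:ℤ)) L, |c j|, fun i => ?_⟩
  by_cases hi : c i = 0
  · rw [hi, abs_zero]; exact Finset.sum_nonneg fun _ _ => abs_nonneg _
  · exact Finset.single_le_sum (f := fun j => |c j|) (fun _ _ => abs_nonneg _)
      (Finset.mem_Icc.2 (h.mem hi))

lemma diffMask_eq {L : ℕ} {c : ℤ → ℝ} (h : Loc L c) (i : ℤ) :
    diffMask c i = ∑ j ∈ Finset.Icc (-(L:ℤ)) i, (-1 : ℝ) ^ (i - j) * c j := by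
  unfold diffMask
  apply finsum_mem_eq_sum_of_inter_support_eq
  ext j
  simp only [Set.mem_inter_iff, Set.mem_setOf_eq, Function.mem_support, Finset.coe_Icc, Set.mem_Icc]
  constructor
  · rintro ⟨h1, h2⟩
    exact ⟨⟨(h.mem (fun h0 => h2 (by simp [h0]))).1, h1⟩, h2⟩
  · rintro ⟨⟨_, h1⟩, h2⟩
    exact ⟨h1, h2⟩

lemma diffMask_add {L : ℕ} {c : ℤ → ℝ} (h : Loc L c) (i : ℤ) :
    c i = diffMask c i + diffMask c (i - 1) := by
  rw [diffMask_eq h, diffMask_eq h]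
  by_cases hi : -(L:ℤ) ≤ i
  · have : Finset.Icc (-(L:ℤ)) i = insert i (Finset.Icc (-(L:ℤ)) (i - 1)) := by
      ext j; simp only [Finset.mem_insert, Finset.mem_Icc]; omega
    rw [this, Finset.sum_insert (by simp), add_assoc, ← Finset.sum_add_distrib,
      Finset.sum_eq_zero]
    · simp
    · intro j _
      have : i - j = (i - 1 - j) + 1 := by ring
      rw [this, zpow_add₀ (by norm_num)]
      simp
  · rw [Finset.Icc_eq_empty (by omega), Finset.Icc_eq_empty (by omega)]
    simp only [Finset.sum_empty, add_zero]
    by_contra h0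
    exact hi (h.mem h0).1

lemma sum_alt {L : ℕ} {c : ℤ → ℝ} (h : Loc L c) (hr : ReproducesConstants c) :
    ∑ j ∈ Finset.Icc (-(2 * L:ℤ)) (2 * L + 1), (-1 : ℝ) ^ j * c j = 0 := by
  obtain ⟨h0, h1⟩ := hr
  have e0 : ∑ i ∈ Finset.Icc (-(L:ℤ)) L, c (2 * i) = 1 := by
    rw [← h0]; symm
    apply finsum_eq_sum_of_support_subset
    intro j hj
    have := h.mem hj
    simp only [Finset.coe_Icc, Set.mem_Icc]; omega
  have e1 : ∑ i ∈ Finset.Icc (-(L:ℤ)) L, c (2 * i + 1) = 1 := by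
    rw [← h1]; symm
    apply finsum_eq_sum_of_support_subset
    intro j hj
    have := h.mem hj
    simp only [Finset.coe_Icc, Set.mem_Icc]; omega
  have hs : Finset.Icc (-(2 * L:ℤ)) (2 * L + 1) =
      (Finset.Icc (-(L:ℤ)) L).image (fun i => 2 * i) ∪
      (Finset.Icc (-(L:ℤ)) L).image (fun i => 2 * i + 1) := by
    ext j
    simp only [Finset.mem_union, Finset.mem_image, Finset.mem_Icc]
    constructor
    · intro hj
      rcases Int.even_or_odd' j with ⟨m, hm | hm⟩
      · left; exact ⟨m, by omega, hm.symm⟩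
      · right; exact ⟨m, by omega, hm.symm⟩
    · rintro (⟨m, hm, rfl⟩ | ⟨m, hm, rfl⟩) <;> omega
  rw [hs, Finset.sum_union, Finset.sum_image (by intro x _ y _ hxy; simp only at hxy; omega),
    Finset.sum_image (by intro x _ y _ hxy; simp only at hxy; omega)]
  · have f0 : ∀ x : ℤ, (-1 : ℝ) ^ (2 * x) = 1 := fun x => by rw [zpow_mul]; norm_num
    have f1 : ∀ x : ℤ, (-1 : ℝ) ^ (2 * x + 1) = -1 := fun x => by
      rw [zpow_add₀ (by norm_num), f0]; norm_num
    simp only [f0, f1, one_mul, neg_mul, Finset.sum_neg_distrib, e0, e1]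
    norm_num
  · rw [Finset.disjoint_left]
    intro j hj hj'
    simp only [Finset.mem_image] at hj hj'
    obtain ⟨m, _, hm⟩ := hj
    obtain ⟨n, _, hn⟩ := hj'
    omega

lemma diffMask_loc {L : ℕ} {c : ℤ → ℝ} (h : Loc L c) (hr : ReproducesConstants c) :
    Loc L (diffMask c) := by
  intro i hi
  rw [diffMask_eq h]
  rcases lt_abs.1 hi with hi | hi
  · have key : ∀ s : Finset ℤ, Finset.Icc (-(L:ℤ)) L ⊆ s →
        ∑ j ∈ s, (-1 : ℝ) ^ j * c j = ∑ j ∈ Finset.Icc (-(L:ℤ)) L, (-1 : ℝ) ^ j * c j := by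
      intro s hs
      symm
      apply Finset.sum_subset hs
      intro j _ hj
      by_contra h0
      exact hj (Finset.mem_Icc.2 (h.mem (fun h1 => h0 (by simp [h1]))))
    have h1 := sum_alt h hr
    rw [key _ (by intro j; simp only [Finset.mem_Icc]; omega)] at h1
    rw [← key (Finset.Icc (-(L:ℤ)) i) (by intro j; simp only [Finset.mem_Icc]; omega)] at h1
    have : ∀ j ∈ Finset.Icc (-(L:ℤ)) i, (-1 : ℝ) ^ (i - j) * c j =
        (-1 : ℝ) ^ i * ((-1 : ℝ) ^ j * c j) := by
      intro j _
      have e : (-1 : ℝ) ^ (i - j) = (-1 : ℝ) ^ i * (-1 : ℝ) ^ j := by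
        rw [sub_eq_add_neg, zpow_add₀ (by norm_num), zpow_neg, ← inv_zpow]; norm_num
      rw [e, mul_assoc]
    rw [Finset.sum_congr rfl this, ← Finset.mul_sum, h1, mul_zero]
  · rw [Finset.Icc_eq_empty (by omega), Finset.sum_empty]

lemma diffMask_sub_bound {L : ℕ} {c d : ℤ → ℝ} (hc : Loc L c) (hd : Loc L d)
    (hqc : Loc L (diffMask c)) (hqd : Loc L (diffMask d)) {M : ℝ}
    (hM : ∀ i, |c i - d i| ≤ M) (i : ℤ) :
    |diffMask c i - diffMask d i| ≤ (2 * L + 1) * M := by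
  have hM0 : 0 ≤ M := (abs_nonneg _).trans (hM 0)
  by_cases hi : (L:ℤ) < |i|
  · rw [hqc i hi, hqd i hi]; simp; positivity
  rw [diffMask_eq hc, diffMask_eq hd, ← Finset.sum_sub_distrib]
  refine (Finset.abs_sum_le_sum_abs _ _).trans ?_
  refine (Finset.sum_le_card_nsmul _ _ M ?_).trans ?_
  · intro j _
    rw [← mul_sub, abs_mul, abs_zpow]
    simpa using hM j
  · rw [nsmul_eq_mul]
    refine mul_le_mul_of_nonneg_right ?_ hM0
    have : (Finset.Icc (-(L:ℤ)) i).card ≤ 2 * L + 1 := by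
      rw [not_lt, abs_le] at hi
      rw [Int.card_Icc]; omega
    exact_mod_cast this

lemma diffMask_zero (i : ℤ) : diffMask (fun _ => 0) i = 0 := by
  simp [diffMask]

lemma diffMask_bound {L : ℕ} {c : ℤ → ℝ} (hc : Loc L c)
    (hqc : Loc L (diffMask c)) {M : ℝ} (hM : ∀ i, |c i| ≤ M) (i : ℤ) :
    |diffMask c i| ≤ (2 * L + 1) * M := by
  have := diffMask_sub_bound (d := fun _ => 0) hc (fun _ _ => rfl) hqc
    (fun i _ => diffMask_zero i) (M := M) (by simpa using hM) i
  simpa [diffMask_zero] using this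

lemma compOps_bound {L : ℕ} {q : ℕ → ℤ → ℝ} (hl : ∀ k, Loc L (q k)) {K : ℕ} {M : ℝ}
    (hM : ∀ k, K ≤ k → ∀ i, |q k i| ≤ M) (n : ℕ) :
    ∃ B : ℝ, ∀ k, K ≤ k → ∀ f : ℤ → ℝ, (∀ i, |f i| ≤ 1) → ∀ i, |compOps q k n f i| ≤ B := by
  induction n with
  | zero => exact ⟨1, fun k _ f hf i => hf i⟩
  | succ n ih =>
    obtain ⟨B, hB⟩ := ih
    refine ⟨(L + 2) * (M * B), fun k hk f hf i => ?_⟩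
    exact subOp_bound (hl _) (hM (k + n) (by omega)) (hB k hk f hf) i

lemma compOps_close {L : ℕ} {q r : ℕ → ℤ → ℝ} (hq : ∀ k, Loc L (q k)) (hr : ∀ k, Loc L (r k))
    {K : ℕ} {M : ℝ}
    (hM : ∀ k, K ≤ k → ∀ i, |q k i| ≤ M) (hM' : ∀ k, K ≤ k → ∀ i, |r k i| ≤ M)
    (hc : ∀ δ > 0, ∃ K', ∀ k, K' ≤ k → ∀ i, |q k i - r k i| ≤ δ) (n : ℕ) :
    ∀ δ > 0, ∃ K', ∀ k, K' ≤ k → ∀ f : ℤ → ℝ, (∀ i, |f i| ≤ 1) →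
      ∀ i, |compOps q k n f i - compOps r k n f i| ≤ δ := by
  induction n with
  | zero =>
    intro δ hδ
    exact ⟨0, fun k _ f hf i => by simpa [compOps] using hδ.le⟩
  | succ n ih =>
    intro δ hδ
    obtain ⟨B, hB⟩ := compOps_bound hr hM' n
    have hM0 : 0 ≤ M := (abs_nonneg _).trans (hM K le_rfl 0)
    have hB0 : 0 ≤ B := (abs_nonneg _).trans (hB K le_rfl (fun _ => 0) (by simp) 0)
    obtain ⟨K1, h1⟩ := ih (δ / (2 * ((L + 2) * (M + 1)))) (by positivity)
    obtain ⟨K2, h2⟩ := hc (δ / (2 * ((L + 2) * (B + 1)))) (by positivity)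
    refine ⟨max K (max K1 K2), fun k hk f hf i => ?_⟩
    have hkK : K ≤ k := (le_max_left _ _).trans hk
    have hkK1 : K1 ≤ k := ((le_max_left _ _).trans (le_max_right _ _)).trans hk
    have hkK2 : K2 ≤ k := ((le_max_right _ _).trans (le_max_right _ _)).trans hk
    change |subOp (q (k + n)) (compOps q k n f) i - subOp (r (k + n)) (compOps r k n f) i| ≤ δ
    rw [subOp_sub (hq _) (hr _)]
    have hcd : Loc L (fun j => q (k + n) j - r (k + n) j) := fun j hj => by
      simp [hq _ j hj, hr _ j hj]
    have t1 := subOp_bound (hq (k + n)) (hM (k + n) (by omega)) (h1 k hkK1 f hf) i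
    have t2 := subOp_bound hcd (h2 (k + n) (by omega)) (hB k hkK f hf) i
    have u1 : ((L:ℝ) + 2) * (M * (δ / (2 * ((L + 2) * (M + 1))))) ≤ δ / 2 := by
      have : ((L:ℝ) + 2) * (M * (δ / (2 * ((L + 2) * (M + 1))))) = δ / 2 * (M / (M + 1)) := by
        field_simp
      rw [this]
      exact mul_le_of_le_one_right (by positivity) ((div_le_one (by positivity)).2 (by linarith))
    have u2 : ((L:ℝ) + 2) * ((δ / (2 * ((L + 2) * (B + 1)))) * B) ≤ δ / 2 := by
      have : ((L:ℝ) + 2) * ((δ / (2 * ((L + 2) * (B + 1)))) * B) = δ / 2 * (B / (B + 1)) := by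
        field_simp
      rw [this]
      exact mul_le_of_le_one_right (by positivity) ((div_le_one (by positivity)).2 (by linarith))
    refine (abs_add_le _ _).trans ?_
    linarith

lemma le_seqNorm {f : ℤ → ℝ} (h : IsBoundedSeq f) (i : ℤ) : |f i| ≤ seqNorm f := by
  obtain ⟨M, hM⟩ := h
  exact le_ciSup (f := fun i => |f i|) ⟨M, by rintro _ ⟨j, rfl⟩; exact hM j⟩ i

lemma seqNorm_le {f : ℤ → ℝ} {M : ℝ} (h : ∀ i, |f i| ≤ M) : seqNorm f ≤ M := ciSup_le h

lemma seqNorm_nonneg (f : ℤ → ℝ) : 0 ≤ seqNorm f := Real.iSup_nonneg fun _ => abs_nonneg _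

lemma opNorm_nonneg (T) : 0 ≤ opNorm T := by
  apply Real.sSup_nonneg
  rintro _ ⟨f, _, _, rfl⟩
  exact seqNorm_nonneg _

lemma opNorm_le {T : (ℤ → ℝ) → ℤ → ℝ} {δ : ℝ} (hδ : 0 ≤ δ)
    (h : ∀ f : ℤ → ℝ, (∀ i, |f i| ≤ 1) → ∀ i, |T f i| ≤ δ) : opNorm T ≤ δ := by
  refine Real.sSup_le ?_ hδ
  rintro _ ⟨f, hf, hf1, rfl⟩
  exact seqNorm_le (h f fun i => (le_seqNorm hf i).trans hf1)

lemma le_opNorm {T : (ℤ → ℝ) → ℤ → ℝ} {C : ℝ}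
    (h : ∀ f : ℤ → ℝ, (∀ i, |f i| ≤ 1) → ∀ i, |T f i| ≤ C)
    (f : ℤ → ℝ) (hf : ∀ i, |f i| ≤ 1) (i : ℤ) : |T f i| ≤ opNorm T := by
  refine (le_seqNorm ⟨C, h f hf⟩ i).trans ?_
  refine le_csSup ⟨C, ?_⟩ ⟨f, ⟨1, hf⟩, seqNorm_le hf, rfl⟩
  rintro _ ⟨g, hg, hg1, rfl⟩
  exact seqNorm_le (h g fun i => (le_seqNorm hg i).trans hg1)

lemma tendsto_zero_iff' {u : ℕ → ℝ} (hu : ∀ k, 0 ≤ u k) :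
    Tendsto u atTop (nhds 0) ↔ ∀ δ > 0, ∃ K, ∀ k, K ≤ k → u k ≤ δ := by
  rw [Metric.tendsto_atTop]
  constructor
  · intro h δ hδ
    obtain ⟨K, hK⟩ := h δ hδ
    refine ⟨K, fun k hk => ?_⟩
    have := hK k hk
    rw [Real.dist_eq, sub_zero, abs_of_nonneg (hu k)] at this
    exact this.le
  · intro h δ hδ
    obtain ⟨K, hK⟩ := h (δ / 2) (by positivity)
    refine ⟨K, fun k hk => ?_⟩
    rw [Real.dist_eq, sub_zero, abs_of_nonneg (hu k)]
    have := hK k hk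
    linarith

/-- for two local schemes reproducing constants, at least one of which is
bounded, asymptotic similarity is equivalent to the convergence to `0`, for every fixed
`p ≥ 0`, of the operator norms `‖S_{q^[k+p]} ⋯ S_{q^[k]} − S_{q*^[k+p]} ⋯ S_{q*^[k]}‖`. -/
theorem asympSimilar_iff_products_close
    (a astar : ℕ → ℤ → ℝ) (N N' : ℕ) (hN : 0 < N) (hN' : 0 < N')
    (hlocal : ∀ k, ∀ i : ℤ, (N : ℤ) < |i| → a k i = 0)
    (hlocal' : ∀ k, ∀ i : ℤ, (N' : ℤ) < |i| → astar k i = 0)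
    (hrc : ∀ k, ReproducesConstants (a k))
    (hrc' : ∀ k, ReproducesConstants (astar k))
    (hbdd : (∃ M : ℝ, ∀ k, ∀ i : ℤ, |a k i| ≤ M) ∨ (∃ M : ℝ, ∀ k, ∀ i : ℤ, |astar k i| ≤ M)) :
    AsympSimilar a astar ↔
      ∀ p : ℕ, Tendsto (fun k =>
          opNorm (fun f i => compOps (fun j => diffMask (a j)) k (p + 1) f i -
            compOps (fun j => diffMask (astar j)) k (p + 1) f i)) atTop (nhds 0) := by
  have hl : ∀ k, Loc (max N N') (a k) := fun k i hi => hlocal k i (by omega)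
  have hl' : ∀ k, Loc (max N N') (astar k) := fun k i hi => hlocal' k i (by omega)
  generalize max N N' = L at hl hl'
  have ql : ∀ k, Loc L (diffMask (a k)) := fun k => diffMask_loc (hl k) (hrc k)
  have ql' : ∀ k, Loc L (diffMask (astar k)) := fun k => diffMask_loc (hl' k) (hrc' k)
  have hd : ∀ k, Loc L (fun i => a k i - astar k i) := fun k i hi => by
    simp [hl k i hi, hl' k i hi]
  have hsim : AsympSimilar a astar ↔
      ∀ δ > 0, ∃ K, ∀ k, K ≤ k → ∀ i, |a k i - astar k i| ≤ δ := by
    unfold AsympSimilar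
    rw [tendsto_zero_iff' fun k => seqNorm_nonneg _]
    constructor
    · intro h δ hδ
      obtain ⟨K, hK⟩ := h δ hδ
      exact ⟨K, fun k hk i =>
        (le_seqNorm (f := fun i => a k i - astar k i) (hd k).bdd i).trans (hK k hk)⟩
    · intro h δ hδ
      obtain ⟨K, hK⟩ := h δ hδ
      exact ⟨K, fun k hk => seqNorm_le (hK k hk)⟩
  rw [hsim]
  constructor
  · intro h p
    rw [tendsto_zero_iff' fun k => opNorm_nonneg _]
    obtain ⟨K, hK⟩ := h 1 one_pos
    obtain ⟨M, h1, h2⟩ : ∃ M : ℝ, (∀ k, K ≤ k → ∀ i, |a k i| ≤ M) ∧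
        (∀ k, K ≤ k → ∀ i, |astar k i| ≤ M) := by
      rcases hbdd with ⟨M, hM⟩ | ⟨M, hM⟩
      · refine ⟨M + 1, fun k _ i => (hM k i).trans (by linarith), fun k hk i => ?_⟩
        have e1 := abs_le.1 (hK k hk i)
        have e2 := abs_le.1 (hM k i)
        rw [abs_le]; constructor <;> linarith
      · refine ⟨M + 1, fun k hk i => ?_, fun k _ i => (hM k i).trans (by linarith)⟩
        have e1 := abs_le.1 (hK k hk i)
        have e2 := abs_le.1 (hM k i)
        rw [abs_le]; constructor <;> linarith
    have hc := compOps_close (q := fun j => diffMask (a j)) (r := fun j => diffMask (astar j))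
      ql ql' (K := K) (M := (2 * L + 1) * M)
      (fun k hk i => diffMask_bound (hl k) (ql k) (h1 k hk) i)
      (fun k hk i => diffMask_bound (hl' k) (ql' k) (h2 k hk) i)
      (by
        intro δ hδ
        obtain ⟨K', hK'⟩ := h (δ / (2 * L + 1)) (by positivity)
        refine ⟨K', fun k hk i => ?_⟩
        refine (diffMask_sub_bound (hl k) (hl' k) (ql k) (ql' k) (hK' k hk) i).trans ?_
        rw [mul_div_cancel₀ _ (by positivity)]) (p + 1)
    intro δ hδ
    obtain ⟨K', hK'⟩ := hc δ hδ
    exact ⟨K', fun k hk => opNorm_le hδ.le (hK' k hk)⟩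
  · intro h δ hδ
    have h0 := h 0
    rw [tendsto_zero_iff' fun k => opNorm_nonneg _] at h0
    obtain ⟨K, hK⟩ := h0 (δ / 2) (by positivity)
    refine ⟨K, fun k hk i => ?_⟩
    have key : ∀ i, |diffMask (a k) i - diffMask (astar k) i| ≤ δ / 2 := by
      intro i
      refine le_trans ?_ (hK k hk)
      obtain ⟨M, hM⟩ := (ql k).bdd
      obtain ⟨M', hM'⟩ := (ql' k).bdd
      have := le_opNorm (T := fun f i => compOps (fun j => diffMask (a j)) k (0 + 1) f i -
            compOps (fun j => diffMask (astar j)) k (0 + 1) f i)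
        (C := (L + 2) * (M * 1) + (L + 2) * (M' * 1)) (by
          intro f hf i
          refine (abs_sub _ _).trans ?_
          exact add_le_add (subOp_bound (ql k) hM hf i) (subOp_bound (ql' k) hM' hf i))
        (fun j => if j = 0 then 1 else 0) (by intro j; split_ifs <;> simp) i
      refine le_trans (le_of_eq ?_) this
      have e : ∀ c : ℕ → ℤ → ℝ, compOps c k (0 + 1) (fun j => if j = 0 then 1 else 0) i = c k i :=
        fun c => subOp_delta (c k) i
      simp only [e]
    rw [diffMask_add (hl k) i, diffMask_add (hl' k) i]
    have e1 := abs_le.1 (key i)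
    have e2 := abs_le.1 (key (i - 1))
    rw [abs_le]; constructor <;> linarith
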